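/- arXiv:2005.12223 — 2 statements merged into one kernel-verified Lean document; each statement's English description precedes it below -/
import Mathlib

section
/- Let ξ, δ ∈ ℝ and 1 ≤ p < ∞. The Hardy-type operator H₀^ξ is of weak type (p,p) with respect to (ℝ₊, x^δ dx) if and only if δ < (ξ+1)p − 1, with the inequality weakened to δ ≤ (ξ+1)p − 1 in case p = 1 and ξ ≠ −1. -/
open MeasureTheory Set ENNReal
open scoped NNReal

noncomputable section

/-- The measure `x^δ dx` on `(0,∞)`. -/
def powMeasure (δ : ℝ) : Measure ℝ :=
  (volume.restrict (Ioi (0:ℝ))).withDensity (fun x => ENNReal.ofReal (x ^ δ))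

/-- `f ∈ L^p(ℝ₊, x^δ dx)` for a real exponent `p`. -/
def MemLpPow (f : ℝ → ℝ) (p δ : ℝ) : Prop :=
  AEMeasurable f (powMeasure δ) ∧
    ∫⁻ x, ENNReal.ofReal |f x| ^ p ∂(powMeasure δ) < ⊤

/-- `T` is of strong type `(p,p)` with respect to `(ℝ₊, x^δ dx)`. -/
def IsStrongType (T : (ℝ → ℝ) → (ℝ → ℝ)) (p δ : ℝ) : Prop :=
  ∃ C : ℝ≥0, ∀ f : ℝ → ℝ, MemLpPow f p δ →
    ∫⁻ x, ENNReal.ofReal |T f x| ^ p ∂(powMeasure δ) ≤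
      C * ∫⁻ x, ENNReal.ofReal |f x| ^ p ∂(powMeasure δ)

/-- `T` is of strong type `(∞,∞)`, i.e. bounded on `L^∞(ℝ₊, dx)`. -/
def IsStrongTypeInfty (T : (ℝ → ℝ) → (ℝ → ℝ)) : Prop :=
  ∃ C : ℝ≥0, ∀ f : ℝ → ℝ,
    eLpNorm (T f) ⊤ (volume.restrict (Ioi (0:ℝ))) ≤
      C * eLpNorm f ⊤ (volume.restrict (Ioi (0:ℝ)))

/-- `T` is of weak type `(p,p)` with respect to `(ℝ₊, x^δ dx)`. -/
def IsWeakType (T : (ℝ → ℝ) → (ℝ → ℝ)) (p δ : ℝ) : Prop :=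
  ∃ C : ℝ≥0, ∀ f : ℝ → ℝ, MemLpPow f p δ → ∀ l : ℝ, 0 < l →
    ENNReal.ofReal (l ^ p) * powMeasure δ {y | l < |T f y|} ≤
      C * ∫⁻ x, ENNReal.ofReal |f x| ^ p ∂(powMeasure δ)

/-- `T` is of restricted weak type `(p,p)` with respect to `(ℝ₊, x^δ dx)`:
the weak type inequality holds uniformly over indicator functions of sets of
finite `x^δ dx` measure. -/
def IsRestrictedWeakType (T : (ℝ → ℝ) → (ℝ → ℝ)) (p δ : ℝ) : Prop :=
  ∃ C : ℝ≥0, ∀ E : Set ℝ, MeasurableSet E → powMeasure δ E < ⊤ → ∀ l : ℝ, 0 < l →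
    ENNReal.ofReal (l ^ p) * powMeasure δ {y | l < |T (E.indicator 1) y|} ≤
      C * powMeasure δ E

/-- The Hardy-type operator `H₀^ξ`. -/
def H0 (ξ : ℝ) (f : ℝ → ℝ) (x : ℝ) : ℝ :=
  x ^ (-ξ - 1) * ∫ y in Ioo (0:ℝ) x, f y * y ^ ξ

lemma lintegral_powMeasure (δ : ℝ) (g : ℝ → ℝ≥0∞) :
    ∫⁻ x, g x ∂(powMeasure δ) = ∫⁻ x in Ioi (0:ℝ), ENNReal.ofReal (x ^ δ) * g x := by
  rw [powMeasure, lintegral_withDensity_eq_lintegral_mul_non_measurable _ (by fun_prop)]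
  · rfl
  · simp

lemma ae_powMeasure_pos (δ : ℝ) : ∀ᵐ x ∂(powMeasure δ), 0 < x :=
  (withDensity_absolutelyContinuous _ _).ae_le (ae_restrict_mem measurableSet_Ioi)

lemma powMeasure_mono_pos {δ : ℝ} {s t : Set ℝ} (h : ∀ x, 0 < x → x ∈ s → x ∈ t) :
    powMeasure δ s ≤ powMeasure δ t :=
  measure_mono_ae ((ae_powMeasure_pos δ).mono fun x hx hs => h x hx hs)

lemma powMeasure_apply_of_subset {δ : ℝ} {s : Set ℝ} (hs : MeasurableSet s) (h : s ⊆ Ioi 0) :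
    powMeasure δ s = ∫⁻ x in s, ENNReal.ofReal (x ^ δ) := by
  rw [powMeasure, withDensity_apply _ hs, Measure.restrict_restrict hs, inter_eq_left.2 h]

lemma aemeasurable_restrict_of_powMeasure {δ : ℝ} {f : ℝ → ℝ}
    (hf : AEMeasurable f (powMeasure δ)) : AEMeasurable f (volume.restrict (Ioi (0:ℝ))) := by
  refine hf.mono_ac (withDensity_absolutelyContinuous' (by fun_prop) ?_)
  filter_upwards [ae_restrict_mem measurableSet_Ioi] with x hx
  simpa using Real.rpow_pos_of_pos hx δ

lemma lintegral_Ioo_rpow {s x : ℝ} (hs : -1 < s) (hx : 0 < x) :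
    ∫⁻ y in Ioo (0:ℝ) x, ENNReal.ofReal (y ^ s) = ENNReal.ofReal (x ^ (s + 1) / (s + 1)) := by
  rw [← ofReal_integral_eq_lintegral_ofReal
    ((intervalIntegral.integrableOn_Ioo_rpow_iff hx).2 hs)]
  · rw [← integral_Ioc_eq_integral_Ioo, ← intervalIntegral.integral_of_le hx.le,
      integral_rpow (Or.inl hs), Real.zero_rpow (by linarith), sub_zero]
  · filter_upwards [ae_restrict_mem measurableSet_Ioo] with y hy
    exact Real.rpow_nonneg hy.1.le _

lemma lintegral_Ioi_rpow {s x : ℝ} (hs : s < -1) (hx : 0 < x) :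
    ∫⁻ y in Ioi x, ENNReal.ofReal (y ^ s) = ENNReal.ofReal (-x ^ (s + 1) / (s + 1)) := by
  rw [← ofReal_integral_eq_lintegral_ofReal (integrableOn_Ioi_rpow_of_lt hs hx),
    integral_Ioi_rpow_of_lt hs hx]
  filter_upwards [ae_restrict_mem measurableSet_Ioi] with y hy
  exact Real.rpow_nonneg (hx.trans hy).le _

lemma ofReal_rpow_mul_ofReal_rpow {x : ℝ} (hx : 0 < x) (a b : ℝ) :
    ENNReal.ofReal (x ^ a) * ENNReal.ofReal (x ^ b) = ENNReal.ofReal (x ^ (a + b)) := by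
  rw [← ENNReal.ofReal_mul (Real.rpow_nonneg hx.le _), Real.rpow_add hx]

lemma ofReal_rpow_rpow {x : ℝ} (hx : 0 < x) (a b : ℝ) :
    ENNReal.ofReal (x ^ a) ^ b = ENNReal.ofReal (x ^ (a * b)) := by
  rw [ENNReal.ofReal_rpow_of_pos (Real.rpow_pos_of_pos hx _), Real.rpow_mul hx.le]

/-- Hölder's inequality for integrals over `(0, x)` with power weights. -/
lemma exists_rpow_lintegral_Ioo_le {ξ p b : ℝ} (hp : 1 < p) (hb : b < (ξ + 1) * p - 1) :
    ∃ K : ℝ≥0, ∀ g : ℝ → ℝ≥0∞, Measurable g → ∀ x : ℝ, 0 < x →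
      (∫⁻ y in Ioo (0:ℝ) x, g y * ENNReal.ofReal (y ^ ξ)) ^ p ≤
        K * ENNReal.ofReal (x ^ ((ξ + 1) * p - 1 - b)) *
          ∫⁻ y in Ioo (0:ℝ) x, g y ^ p * ENNReal.ofReal (y ^ b) := by
  have hp0 : 0 < p := by linarith
  have hp1 : p - 1 ≠ 0 := by linarith
  obtain ⟨q, hq⟩ : ∃ q, q = p / (p - 1) := ⟨_, rfl⟩
  have hpq : p.HolderConjugate q := by
    rw [hq]; exact Real.HolderConjugate.conjExponent hp
  have hq0 : 0 < q := hpq.symm.pos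
  have hpq' : p / q = p - 1 := by rw [hq]; field_simp
  have hs : -1 < (ξ - b / p) * q := by
    have : 0 < (ξ - b / p) * q + 1 := by
      have e : (ξ - b / p) * q + 1 = ((ξ + 1) * p - 1 - b) / (p - 1) := by
        rw [hq]; field_simp; ring
      rw [e]
      exact div_pos (by linarith) (by linarith)
    linarith
  refine ⟨((1 / ((ξ - b / p) * q + 1)) ^ (p - 1)).toNNReal, fun g hg x hx => ?_⟩
  have h1 : ∫⁻ y in Ioo (0:ℝ) x, g y * ENNReal.ofReal (y ^ ξ) =
      ∫⁻ y in Ioo (0:ℝ) x, ((fun y => g y * ENNReal.ofReal (y ^ (b / p))) *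
        (fun y => ENNReal.ofReal (y ^ (ξ - b / p)))) y := by
    refine setLIntegral_congr_fun measurableSet_Ioo fun y hy => ?_
    simp only [Pi.mul_apply]
    rw [mul_assoc, ofReal_rpow_mul_ofReal_rpow hy.1]
    congr 4; ring
  have h2 : ∫⁻ y in Ioo (0:ℝ) x, (g y * ENNReal.ofReal (y ^ (b / p))) ^ p =
      ∫⁻ y in Ioo (0:ℝ) x, g y ^ p * ENNReal.ofReal (y ^ b) := by
    refine setLIntegral_congr_fun measurableSet_Ioo fun y hy => ?_
    rw [ENNReal.mul_rpow_of_nonneg _ _ hp0.le, ofReal_rpow_rpow hy.1, div_mul_cancel₀ _ hp0.ne']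
  have h3 : ∫⁻ y in Ioo (0:ℝ) x, ENNReal.ofReal (y ^ (ξ - b / p)) ^ q =
      ENNReal.ofReal (x ^ ((ξ - b / p) * q + 1) / ((ξ - b / p) * q + 1)) := by
    rw [← lintegral_Ioo_rpow hs hx]
    refine setLIntegral_congr_fun measurableSet_Ioo fun y hy => ?_
    rw [ofReal_rpow_rpow hy.1]
  have hpos : 0 < (ξ - b / p) * q + 1 := by linarith
  calc _ ≤ ((∫⁻ y in Ioo (0:ℝ) x, (g y * ENNReal.ofReal (y ^ (b / p))) ^ p) ^ (1 / p) *
        (∫⁻ y in Ioo (0:ℝ) x, ENNReal.ofReal (y ^ (ξ - b / p)) ^ q) ^ (1 / q)) ^ p := by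
        rw [h1]
        gcongr
        exact ENNReal.lintegral_mul_le_Lp_mul_Lq _ hpq (by fun_prop) (by fun_prop)
    _ = _ := by
        rw [h2, h3, ENNReal.mul_rpow_of_nonneg _ _ hp0.le, ← ENNReal.rpow_mul, ← ENNReal.rpow_mul,
          one_div_mul_cancel hp0.ne', ENNReal.rpow_one, mul_comm]
        congr 1
        rw [show 1 / q * p = p - 1 by rw [← hpq']; ring,
          ENNReal.ofReal_rpow_of_pos (by positivity), div_eq_mul_one_div, mul_comm (x ^ _),
          Real.mul_rpow (by positivity) (by positivity), ENNReal.ofReal_mul (by positivity),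
          ← Real.rpow_mul hx.le]
        congr 4
        rw [hq]; field_simp; ring

lemma measurable_lintegral_Ioo (h : ℝ → ℝ≥0∞) :
    Measurable fun x : ℝ => ∫⁻ y in Ioo (0:ℝ) x, h y :=
  Monotone.measurable fun _ _ hab => lintegral_mono_set (Ioo_subset_Ioo_right hab)

lemma lintegral_rpow_mul_lintegral_Ioo {c : ℝ} (hc : c < -1) {h : ℝ → ℝ≥0∞} (hh : Measurable h) :
    ∫⁻ x in Ioi (0:ℝ), ENNReal.ofReal (x ^ c) * ∫⁻ y in Ioo (0:ℝ) x, h y =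
      ∫⁻ y in Ioi (0:ℝ), ENNReal.ofReal (-y ^ (c + 1) / (c + 1)) * h y := by
  have h1 : ∀ x : ℝ, ENNReal.ofReal (x ^ c) * ∫⁻ y in Ioo (0:ℝ) x, h y =
      ∫⁻ y in Ioi (0:ℝ), {z : ℝ × ℝ | z.2 < z.1}.indicator
        (fun z => ENNReal.ofReal (z.1 ^ c) * h z.2) (x, y) := by
    intro x
    rw [← lintegral_const_mul _ hh, ← Ioi_inter_Iio, inter_comm,
      ← Measure.restrict_restrict measurableSet_Iio, ← lintegral_indicator measurableSet_Iio]
    rfl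
  have h2 : ∀ y ∈ Ioi (0:ℝ), ∫⁻ x in Ioi (0:ℝ), {z : ℝ × ℝ | z.2 < z.1}.indicator
        (fun z => ENNReal.ofReal (z.1 ^ c) * h z.2) (x, y) =
      ENNReal.ofReal (-y ^ (c + 1) / (c + 1)) * h y := by
    intro y hy
    rw [← lintegral_Ioi_rpow hc hy, ← lintegral_mul_const _ (by fun_prop)]
    have : Ioi y = Ioi y ∩ Ioi 0 := (inter_eq_left.2 (Ioi_subset_Ioi (le_of_lt hy))).symm
    rw [this, ← Measure.restrict_restrict measurableSet_Ioi]
    exact lintegral_indicator measurableSet_Ioi fun x => ENNReal.ofReal (x ^ c) * h y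
  simp_rw [h1]
  rw [lintegral_lintegral_swap]
  · exact setLIntegral_congr_fun measurableSet_Ioi h2
  · refine Measurable.aemeasurable ?_
    exact Measurable.indicator (by fun_prop) (measurableSet_lt measurable_snd measurable_fst)

lemma ofReal_abs_H0_le (ξ : ℝ) (f : ℝ → ℝ) {x : ℝ} (hx : 0 < x) :
    ENNReal.ofReal |H0 ξ f x| ≤ ENNReal.ofReal (x ^ (-ξ - 1)) *
      ∫⁻ y in Ioo (0:ℝ) x, ENNReal.ofReal |f y| * ENNReal.ofReal (y ^ ξ) := by
  rw [H0, abs_mul, abs_of_pos (Real.rpow_pos_of_pos hx _),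
    ENNReal.ofReal_mul (Real.rpow_nonneg hx.le _)]
  gcongr
  rw [← Real.enorm_eq_ofReal_abs]
  refine (enorm_integral_le_lintegral_enorm _).trans_eq ?_
  refine setLIntegral_congr_fun measurableSet_Ioo fun y hy => ?_
  rw [enorm_mul, Real.enorm_eq_ofReal_abs, Real.enorm_of_nonneg (Real.rpow_nonneg hy.1.le _)]

/-- A weighted `L^p` bound for integrals over `(0, x)` implies the weak type inequality. -/
lemma isWeakType_H0_of_rpow_lintegral_Ioo_le {ξ δ p b : ℝ} (hp : 1 ≤ p) (hδ : δ < b) {K : ℝ≥0}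
    (hK : ∀ g : ℝ → ℝ≥0∞, Measurable g → ∀ x : ℝ, 0 < x →
      (∫⁻ y in Ioo (0:ℝ) x, g y * ENNReal.ofReal (y ^ ξ)) ^ p ≤
        K * ENNReal.ofReal (x ^ ((ξ + 1) * p - 1 - b)) *
          ∫⁻ y in Ioo (0:ℝ) x, g y ^ p * ENNReal.ofReal (y ^ b)) :
    IsWeakType (H0 ξ) p δ := by
  have hp0 : 0 < p := by linarith
  refine ⟨K * (1 / (b - δ)).toNNReal, fun f hf l hl => ?_⟩
  have hm := aemeasurable_restrict_of_powMeasure hf.1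
  set f' := hm.mk f
  have hf' : Measurable f' := hm.measurable_mk
  have hae : f =ᵐ[volume.restrict (Ioi (0:ℝ))] f' := hm.ae_eq_mk
  set g : ℝ → ℝ≥0∞ := fun y => ENNReal.ofReal |f' y|
  have hg : Measurable g := by fun_prop
  set h : ℝ → ℝ≥0∞ := fun y => g y ^ p * ENNReal.ofReal (y ^ b)
  have hh : Measurable h := by fun_prop
  set A : ℝ → ℝ≥0∞ := fun x => K * (ENNReal.ofReal (x ^ (-b - 1)) * ∫⁻ y in Ioo (0:ℝ) x, h y)
  have hA : Measurable A :=
    ((by fun_prop : Measurable fun x : ℝ => ENNReal.ofReal (x ^ (-b - 1))).mul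
      (measurable_lintegral_Ioo h)).const_mul _
  have hbound : ∀ x : ℝ, 0 < x → ENNReal.ofReal |H0 ξ f x| ^ p ≤ A x := by
    intro x hx
    have hI : ∫⁻ y in Ioo (0:ℝ) x, ENNReal.ofReal |f y| * ENNReal.ofReal (y ^ ξ) =
        ∫⁻ y in Ioo (0:ℝ) x, g y * ENNReal.ofReal (y ^ ξ) := by
      refine lintegral_congr_ae ?_
      filter_upwards [ae_restrict_of_ae_restrict_of_subset Ioo_subset_Ioi_self hae] with y hy
      rw [hy]
    calc _ ≤ (ENNReal.ofReal (x ^ (-ξ - 1)) *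
          ∫⁻ y in Ioo (0:ℝ) x, g y * ENNReal.ofReal (y ^ ξ)) ^ p := by
          rw [← hI]
          gcongr
          exact ofReal_abs_H0_le ξ f hx
      _ ≤ ENNReal.ofReal (x ^ ((-ξ - 1) * p)) *
          (K * ENNReal.ofReal (x ^ ((ξ + 1) * p - 1 - b)) * ∫⁻ y in Ioo (0:ℝ) x, h y) := by
          rw [ENNReal.mul_rpow_of_nonneg _ _ hp0.le, ofReal_rpow_rpow hx]
          gcongr
          exact hK g hg x hx
      _ = K * (ENNReal.ofReal (x ^ ((-ξ - 1) * p)) * ENNReal.ofReal (x ^ ((ξ + 1) * p - 1 - b)) *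
          ∫⁻ y in Ioo (0:ℝ) x, h y) := by ring
      _ = A x := by
          rw [ofReal_rpow_mul_ofReal_rpow hx,
            show (-ξ - 1) * p + ((ξ + 1) * p - 1 - b) = -b - 1 by ring]
  calc _ ≤ ENNReal.ofReal (l ^ p) * powMeasure δ {x | ENNReal.ofReal (l ^ p) ≤ A x} := by
        gcongr ENNReal.ofReal (l ^ p) * ?_
        refine powMeasure_mono_pos fun x hx hlx => ?_
        refine le_trans ?_ (hbound x hx)
        rw [← ENNReal.ofReal_rpow_of_pos hl]
        gcongr
        exact le_of_lt hlx
    _ ≤ ∫⁻ x, A x ∂(powMeasure δ) := mul_meas_ge_le_lintegral hA _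
    _ = K * ∫⁻ x in Ioi (0:ℝ), ENNReal.ofReal (x ^ (δ - b - 1)) * ∫⁻ y in Ioo (0:ℝ) x, h y := by
        rw [lintegral_powMeasure, ← lintegral_const_mul' _ _ coe_ne_top]
        refine setLIntegral_congr_fun measurableSet_Ioi fun x hx => ?_
        simp only [A]
        rw [show δ - b - 1 = δ + (-b - 1) by ring, ← ofReal_rpow_mul_ofReal_rpow hx]
        ring
    _ = K * (ENNReal.ofReal (1 / (b - δ)) *
          ∫⁻ x in Ioi (0:ℝ), ENNReal.ofReal (x ^ δ) * g x ^ p) := by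
        rw [lintegral_rpow_mul_lintegral_Ioo (by linarith) hh,
          ← lintegral_const_mul' (ENNReal.ofReal _) _ ofReal_ne_top]
        congr 1
        refine setLIntegral_congr_fun measurableSet_Ioi fun x hx => ?_
        simp only [h]
        rw [show -x ^ (δ - b - 1 + 1) / (δ - b - 1 + 1) = 1 / (b - δ) * x ^ (δ - b) by
          rw [show δ - b - 1 + 1 = -(b - δ) by ring, neg_div_neg_eq,
            show δ - b = -(b - δ) by ring]; ring,
          ENNReal.ofReal_mul (one_div_nonneg.2 (by linarith)),
          show ENNReal.ofReal (x ^ δ) = ENNReal.ofReal (x ^ (δ - b)) * ENNReal.ofReal (x ^ b) by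
            rw [ofReal_rpow_mul_ofReal_rpow hx, sub_add_cancel]]
        ring
    _ = _ := by
        rw [lintegral_powMeasure, ← mul_assoc, ENNReal.coe_mul]
        congr 1
        refine lintegral_congr_ae ?_
        filter_upwards [hae] with y hy
        rw [hy]

lemma isWeakType_H0_of_lt {ξ δ p : ℝ} (hp : 1 ≤ p) (hδ : δ < (ξ + 1) * p - 1) :
    IsWeakType (H0 ξ) p δ := by
  rcases hp.eq_or_lt with rfl | hp'
  · refine isWeakType_H0_of_rpow_lintegral_Ioo_le le_rfl (b := ξ) (K := 1) (by linarith)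
      fun g _ x _ => ?_
    simp
  · obtain ⟨b, hb1, hb2⟩ := exists_between hδ
    obtain ⟨K, hK⟩ := exists_rpow_lintegral_Ioo_le hp' hb2
    exact isWeakType_H0_of_rpow_lintegral_Ioo_le hp hb1 hK

lemma isWeakType_H0_one_self {ξ : ℝ} (hξ : ξ ≠ -1) : IsWeakType (H0 ξ) 1 ξ := by
  refine ⟨(1 / |ξ + 1|).toNNReal, fun f hf l hl => ?_⟩
  have hr : ξ + 1 ≠ 0 := fun h => hξ (by linarith)
  have hfin := hf.2
  rw [lintegral_powMeasure] at hfin ⊢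
  simp only [ENNReal.rpow_one, Real.rpow_one] at hfin ⊢
  set N := ∫⁻ x in Ioi (0:ℝ), ENNReal.ofReal (x ^ ξ) * ENNReal.ofReal |f x|
  obtain ⟨n, hn⟩ : ∃ n, n = N.toReal := ⟨_, rfl⟩
  have hN : N = ENNReal.ofReal n := by rw [hn, ENNReal.ofReal_toReal hfin.ne]
  have hn0 : 0 ≤ n := hn ▸ ENNReal.toReal_nonneg
  have key : ∀ x : ℝ, 0 < x → l < |H0 ξ f x| → l < x ^ (-(ξ + 1)) * n := by
    intro x hx hlx
    refine hlx.trans_le ?_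
    rw [← ENNReal.ofReal_le_ofReal_iff (mul_nonneg (Real.rpow_nonneg hx.le _) hn0),
      ENNReal.ofReal_mul (Real.rpow_nonneg hx.le _), ← hN, neg_add']
    refine (ofReal_abs_H0_le ξ f hx).trans ?_
    gcongr
    simp_rw [mul_comm (ENNReal.ofReal |f _|)]
    exact lintegral_mono_set Ioo_subset_Ioi_self
  have key2 : ∀ x : ℝ, 0 < x → l < |H0 ξ f x| → x ^ (ξ + 1) < n / l := by
    intro x hx hlx
    have h := key x hx hlx
    have hx' := Real.rpow_pos_of_pos hx (ξ + 1)
    rw [Real.rpow_neg hx.le, inv_mul_eq_div, lt_div_iff₀ hx'] at h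
    rw [lt_div_iff₀ hl]; linarith
  have concl : powMeasure ξ {y | l < |H0 ξ f y|} ≤ ENNReal.ofReal (n / l * (1 / |ξ + 1|)) := by
    rcases hn0.eq_or_lt with h0 | hnpos
    · refine (powMeasure_mono_pos (t := ∅) fun x hx hlx => ?_).trans (by simp)
      have := key2 x hx hlx
      rw [← h0, zero_div] at this
      exact absurd this (Real.rpow_nonneg hx.le _).not_gt
    have ht : 0 < n / l := div_pos hnpos hl
    have hT : 0 < (n / l) ^ (ξ + 1)⁻¹ := Real.rpow_pos_of_pos ht _
    have hTT : ((n / l) ^ (ξ + 1)⁻¹) ^ (ξ + 1) = n / l := Real.rpow_inv_rpow ht.le hr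
    rcases hr.lt_or_gt with hneg | hpos
    · refine (powMeasure_mono_pos (t := Ioi ((n / l) ^ (ξ + 1)⁻¹)) fun x hx hlx => ?_).trans ?_
      · have := key2 x hx hlx
        rw [← hTT] at this
        exact (Real.rpow_lt_rpow_iff_of_neg hx hT hneg).1 this
      · rw [powMeasure_apply_of_subset measurableSet_Ioi (Ioi_subset_Ioi hT.le),
          lintegral_Ioi_rpow (by linarith) hT, hTT, abs_of_neg hneg, neg_div, ← div_neg,
          div_eq_mul_one_div (n / l)]
    · refine (powMeasure_mono_pos (t := Ioo 0 ((n / l) ^ (ξ + 1)⁻¹)) fun x hx hlx => ?_).trans ?_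
      · have := key2 x hx hlx
        rw [← hTT] at this
        exact ⟨hx, (Real.rpow_lt_rpow_iff hx.le hT.le hpos).1 this⟩
      · rw [powMeasure_apply_of_subset measurableSet_Ioo Ioo_subset_Ioi_self,
          lintegral_Ioo_rpow (by linarith) hT, hTT, abs_of_pos hpos,
          div_eq_mul_one_div (n / l)]
  calc _ ≤ ENNReal.ofReal l * ENNReal.ofReal (n / l * (1 / |ξ + 1|)) := by gcongr
    _ = ENNReal.ofReal (1 / |ξ + 1|) * ENNReal.ofReal n := by
        rw [← ENNReal.ofReal_mul hl.le, ← ENNReal.ofReal_mul (by positivity)]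
        congr 1; field_simp
    _ = _ := by rw [hN]; rfl

lemma min_one_two_rpow_le {x : ℝ} (hx : x ∈ Ioo (1:ℝ) 2) (s : ℝ) : min 1 (2 ^ s) ≤ x ^ s := by
  rcases le_or_gt 0 s with hs | hs
  · exact (min_le_left _ _).trans (Real.one_le_rpow hx.1.le hs)
  · exact (min_le_right _ _).trans
      (Real.rpow_le_rpow_of_nonpos (by linarith [hx.1]) hx.2.le hs.le)

/-- Testing the weak type inequality on functions supported in `(0, 1)`. -/
lemma exists_rpow_setIntegral_le_of_isWeakType {ξ δ p : ℝ}
    (h : IsWeakType (H0 ξ) p δ) :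
    ∃ C : ℝ, ∀ f : ℝ → ℝ, Measurable f → (∀ y ∉ Ioo (0:ℝ) 1, f y = 0) →
      ∀ N : ℝ, 0 ≤ N →
      ∫⁻ y in Ioi (0:ℝ), ENNReal.ofReal (y ^ δ) * ENNReal.ofReal |f y| ^ p ≤ ENNReal.ofReal N →
      0 < ∫ y in Ioo (0:ℝ) 1, f y * y ^ ξ → (∫ y in Ioo (0:ℝ) 1, f y * y ^ ξ) ^ p ≤ C * N := by
  obtain ⟨C, hC⟩ := h
  obtain ⟨c, hc⟩ : ∃ c : ℝ, c = min 1 (2 ^ (-ξ - 1)) := ⟨_, rfl⟩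
  obtain ⟨d, hd⟩ : ∃ d : ℝ, d = min 1 (2 ^ δ) := ⟨_, rfl⟩
  have hc0 : 0 < c := hc ▸ lt_min one_pos (by positivity)
  have hd0 : 0 < d := hd ▸ lt_min one_pos (by positivity)
  refine ⟨C / (d * (c / 2) ^ p), fun f hf hsupp N hN hfN hI => ?_⟩
  set I := ∫ y in Ioo (0:ℝ) 1, f y * y ^ ξ
  have hfmem : MemLpPow f p δ := by
    refine ⟨hf.aemeasurable, ?_⟩
    rw [lintegral_powMeasure]
    exact hfN.trans_lt ofReal_lt_top
  have hl : 0 < c / 2 * I := by positivity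
  have hsub : Ioo (1:ℝ) 2 ⊆ {y | c / 2 * I < |H0 ξ f y|} := by
    intro x hx
    have hIx : ∫ y in Ioo (0:ℝ) x, f y * y ^ ξ = I := by
      refine setIntegral_eq_of_subset_of_forall_sdiff_eq_zero measurableSet_Ioo
        (Ioo_subset_Ioo_right hx.1.le) fun y hy => ?_
      rw [hsupp y hy.2, zero_mul]
    have := min_one_two_rpow_le hx (-ξ - 1)
    rw [← hc] at this
    rw [mem_ofPred_eq, H0, hIx]
    refine lt_of_lt_of_le ?_ (le_abs_self _)
    exact mul_lt_mul_of_pos_right (by linarith) hI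
  have hmeas : ENNReal.ofReal d ≤ powMeasure δ {y | c / 2 * I < |H0 ξ f y|} := by
    refine le_trans ?_ (measure_mono hsub)
    rw [powMeasure_apply_of_subset measurableSet_Ioo fun x hx => zero_lt_one.trans hx.1]
    calc ENNReal.ofReal d = ∫⁻ _ in Ioo (1:ℝ) 2, ENNReal.ofReal d := by
          rw [setLIntegral_const, Real.volume_Ioo]; norm_num
      _ ≤ _ := setLIntegral_mono' measurableSet_Ioo fun x hx =>
          ENNReal.ofReal_le_ofReal (hd ▸ min_one_two_rpow_le hx δ)
  have key := hC f hfmem _ hl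
  rw [lintegral_powMeasure] at key
  have key2 : ENNReal.ofReal ((c / 2 * I) ^ p * d) ≤ ENNReal.ofReal (C * N) := by
    rw [ENNReal.ofReal_mul (by positivity), ENNReal.ofReal_mul C.coe_nonneg, ENNReal.ofReal_coe_nnreal]
    calc _ ≤ _ := by gcongr
      _ ≤ _ := key
      _ ≤ _ := by gcongr
  rw [ENNReal.ofReal_le_ofReal_iff (by positivity), Real.mul_rpow (by positivity) hI.le] at key2
  rw [div_mul_eq_mul_div, le_div_iff₀ (by positivity)]
  linarith

lemma exists_rpow_gt {a : ℝ} (ha : 0 < a) (C : ℝ) : ∃ t : ℝ, 1 < t ∧ C < t ^ a := by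
  obtain ⟨t, h1, h2⟩ := ((tendsto_rpow_atTop ha).eventually_gt_atTop C).and
    (Filter.eventually_gt_atTop 1) |>.exists
  exact ⟨t, h2, h1⟩

lemma lt_of_isWeakType_H0 {ξ δ p : ℝ} (hp : 1 < p) (h : IsWeakType (H0 ξ) p δ) :
    δ < (ξ + 1) * p - 1 := by
  by_contra! hδ
  have hp0 : 0 < p := by linarith
  obtain ⟨C, hC⟩ := exists_rpow_setIntegral_le_of_isWeakType h
  obtain ⟨L, hL1, hL⟩ := exists_rpow_gt (sub_pos.2 hp) C
  have hL0 : 0 < L := by linarith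
  set ε := Real.exp (-L) with hε
  have hε0 : 0 < ε := Real.exp_pos _
  have hε1 : ε < 1 := Real.exp_lt_one_iff.2 (by linarith)
  have hlog : ∫ y in Ioo ε 1, y⁻¹ = L := by
    rw [← integral_Ioc_eq_integral_Ioo, ← intervalIntegral.integral_of_le hε1.le,
      integral_inv_of_pos hε0 one_pos, hε, one_div, ← Real.exp_neg, neg_neg, Real.log_exp]
  have hsub : Ioo ε 1 ⊆ Ioo 0 1 := Ioo_subset_Ioo_left hε0.le
  have hint : IntegrableOn (fun y : ℝ => y⁻¹) (Ioo ε 1) := by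
    have : IntervalIntegrable (fun y : ℝ => y⁻¹) volume ε 1 :=
      intervalIntegral.intervalIntegrable_inv
        (fun x hx => by rw [uIcc_of_le hε1.le] at hx; exact (hε0.trans_le hx.1).ne')
        continuousOn_id
    exact (intervalIntegrable_iff_integrableOn_Ioo_of_le hε1.le).1 this
  have hI : ∫ y in Ioo (0:ℝ) 1, (Ioo ε 1).indicator (fun y => y ^ (-ξ - 1)) y * y ^ ξ = L := by
    rw [← hlog, setIntegral_eq_of_subset_of_forall_sdiff_eq_zero measurableSet_Ioo hsub
      fun y hy => by rw [indicator_of_notMem hy.2, zero_mul]]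
    refine setIntegral_congr_fun measurableSet_Ioo fun y hy => ?_
    have hy0 := (hsub hy).1
    rw [indicator_of_mem hy, ← Real.rpow_add hy0, ← Real.rpow_neg_one]
    congr 1; ring
  have := hC ((Ioo ε 1).indicator fun y => y ^ (-ξ - 1))
    (Measurable.indicator (by fun_prop) measurableSet_Ioo)
    (fun y hy => indicator_of_notMem (fun h => hy (hsub h)) _) L hL0.le ?_ (hL0.trans_eq hI.symm)
  · rw [hI] at this
    have e : L ^ p = L ^ (p - 1) * L := by
      rw [← Real.rpow_add_one hL0.ne', sub_add_cancel]
    rw [e] at this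
    exact (le_of_mul_le_mul_right this hL0).not_gt hL
  · rw [← hlog, ofReal_integral_eq_lintegral_ofReal hint ?_,
      ← lintegral_indicator measurableSet_Ioi, ← lintegral_indicator measurableSet_Ioo]
    · refine lintegral_mono fun y => ?_
      by_cases hy : y ∈ Ioo ε 1
      · have hy0 := (hsub hy).1
        rw [indicator_of_mem (show y ∈ Ioi 0 from hy0), indicator_of_mem hy, indicator_of_mem hy,
          abs_of_pos (Real.rpow_pos_of_pos hy0 _), ofReal_rpow_rpow hy0,
          ofReal_rpow_mul_ofReal_rpow hy0, ← Real.rpow_neg_one]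
        refine ENNReal.ofReal_le_ofReal ?_
        exact Real.rpow_le_rpow_of_exponent_ge hy0 hy.2.le (by linarith)
      · by_cases hy0 : y ∈ Ioi (0:ℝ)
        · rw [indicator_of_mem hy0, indicator_of_notMem hy, abs_zero, ENNReal.ofReal_zero,
            ENNReal.zero_rpow_of_pos hp0, mul_zero]
          exact zero_le
        · rw [indicator_of_notMem hy0]
          exact zero_le
    · filter_upwards [ae_restrict_mem measurableSet_Ioo] with y hy
      exact inv_nonneg.2 (hsub hy).1.le

lemma le_of_isWeakType_H0_one {ξ δ : ℝ} (h : IsWeakType (H0 ξ) 1 δ) : δ ≤ ξ := by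
  by_contra! hδ
  obtain ⟨C, hC⟩ := exists_rpow_setIntegral_le_of_isWeakType h
  obtain ⟨t, ht1, ht⟩ := exists_rpow_gt (sub_pos.2 hδ) C
  have ht0 : 0 < t := by linarith
  obtain ⟨ε, hε⟩ : ∃ ε, ε = t⁻¹ := ⟨_, rfl⟩
  have hε0 : 0 < ε := hε ▸ inv_pos.2 ht0
  have hε1 : ε < 1 := hε ▸ inv_lt_one_of_one_lt₀ ht1
  have hsub : Ioo 0 ε ⊆ Ioo 0 1 := Ioo_subset_Ioo_right hε1.le
  have hI : ∫ y in Ioo (0:ℝ) 1, (Ioo 0 ε).indicator (fun y => y ^ (-ξ)) y * y ^ ξ = ε := by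
    rw [setIntegral_eq_of_subset_of_forall_sdiff_eq_zero measurableSet_Ioo hsub
      fun y hy => by rw [indicator_of_notMem hy.2, zero_mul]]
    rw [setIntegral_congr_fun (g := fun _ => (1:ℝ)) measurableSet_Ioo fun y hy => ?_]
    · simp [hε0.le]
    · have hy0 := (hsub hy).1
      simp only
      rw [indicator_of_mem hy, ← Real.rpow_add hy0, neg_add_cancel, Real.rpow_zero]
  have := hC ((Ioo 0 ε).indicator fun y => y ^ (-ξ))
    (Measurable.indicator (by fun_prop) measurableSet_Ioo)
    (fun y hy => indicator_of_notMem (fun h => hy (hsub h)) _) (ε ^ (δ - ξ) * ε)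
    (by positivity) ?_ (hε0.trans_eq hI.symm)
  · rw [hI, Real.rpow_one, ← mul_assoc] at this
    have h1 : 1 ≤ C * ε ^ (δ - ξ) := le_of_mul_le_mul_right (by linarith) hε0
    rw [hε, Real.inv_rpow ht0.le, ← div_eq_mul_inv, le_div_iff₀ (by positivity)] at h1
    linarith
  · calc _ ≤ ∫⁻ _ in Ioo (0:ℝ) ε, ENNReal.ofReal (ε ^ (δ - ξ)) := by
          rw [← lintegral_indicator measurableSet_Ioi, ← lintegral_indicator measurableSet_Ioo]
          refine lintegral_mono fun y => ?_
          by_cases hy : y ∈ Ioo 0 ε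
          · have hy0 := hy.1
            rw [indicator_of_mem (show y ∈ Ioi 0 from hy0), indicator_of_mem hy,
              indicator_of_mem hy, abs_of_pos (Real.rpow_pos_of_pos hy0 _), ENNReal.rpow_one,
              ofReal_rpow_mul_ofReal_rpow hy0, ← sub_eq_add_neg]
            exact ENNReal.ofReal_le_ofReal (Real.rpow_le_rpow hy0.le hy.2.le (by linarith))
          · by_cases hy0 : y ∈ Ioi (0:ℝ)
            · rw [indicator_of_mem hy0, indicator_of_notMem hy, abs_zero, ENNReal.ofReal_zero,
                ENNReal.rpow_one, mul_zero]
              exact zero_le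
            · rw [indicator_of_notMem hy0]
              exact zero_le
      _ = _ := by
          rw [setLIntegral_const, Real.volume_Ioo, sub_zero, ENNReal.ofReal_mul (by positivity)]

lemma powMeasure_neg_one_Ioi_two : powMeasure (-1) (Ioi 2) = ⊤ := by
  rw [powMeasure_apply_of_subset measurableSet_Ioi (Ioi_subset_Ioi (by norm_num))]
  by_contra hne
  have : IntegrableOn (fun y : ℝ => y ^ (-1 : ℝ)) (Ioi 2) := by
    refine ⟨by fun_prop, ?_⟩
    rw [hasFiniteIntegral_iff_ofReal]
    · exact lt_top_iff_ne_top.2 hne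
    · filter_upwards [ae_restrict_mem measurableSet_Ioi] with y hy
      exact Real.rpow_nonneg (zero_lt_two.trans hy).le _
  exact lt_irrefl _ ((integrableOn_Ioi_rpow_iff zero_lt_two).1 this)

lemma not_isWeakType_H0_neg_one : ¬ IsWeakType (H0 (-1)) 1 (-1) := by
  rintro ⟨C, hC⟩
  set f : ℝ → ℝ := (Ioo 1 2).indicator fun y => y with hf
  have hfm : Measurable f := measurable_id.indicator measurableSet_Ioo
  have hN : ∫⁻ x, ENNReal.ofReal |f x| ^ (1:ℝ) ∂(powMeasure (-1)) ≤ 1 := by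
    rw [lintegral_powMeasure]
    calc _ ≤ ∫⁻ _ in Ioo (1:ℝ) 2, 1 := by
          rw [← lintegral_indicator measurableSet_Ioi, ← lintegral_indicator measurableSet_Ioo]
          refine lintegral_mono fun y => ?_
          by_cases hy : y ∈ Ioo (1:ℝ) 2
          · have hy0 : 0 < y := zero_lt_one.trans hy.1
            rw [indicator_of_mem (show y ∈ Ioi 0 from hy0), hf, indicator_of_mem hy,
              indicator_of_mem hy, abs_of_pos hy0, ENNReal.rpow_one,
              ← ENNReal.ofReal_mul (Real.rpow_nonneg hy0.le _), Real.rpow_neg_one,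
              inv_mul_cancel₀ hy0.ne', ENNReal.ofReal_one]
          · by_cases hy0 : y ∈ Ioi (0:ℝ)
            · rw [indicator_of_mem hy0, hf, indicator_of_notMem hy, abs_zero, ENNReal.ofReal_zero,
                ENNReal.rpow_one, mul_zero]
              exact zero_le
            · rw [indicator_of_notMem hy0]
              exact zero_le
      _ = 1 := by rw [setLIntegral_const, Real.volume_Ioo]; norm_num
  have hsub : Ioi (2:ℝ) ⊆ {y | 1 / 2 < |H0 (-1) f y|} := by
    intro x hx
    have hI : ∫ y in Ioo (0:ℝ) x, f y * y ^ (-1:ℝ) = 1 := by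
      rw [setIntegral_eq_of_subset_of_forall_sdiff_eq_zero measurableSet_Ioo
        (Ioo_subset_Ioo zero_le_one (le_of_lt hx) : Ioo 1 2 ⊆ Ioo 0 x)
        fun y hy => by rw [hf, indicator_of_notMem hy.2, zero_mul]]
      rw [setIntegral_congr_fun (g := fun _ => (1:ℝ)) measurableSet_Ioo fun y hy => ?_]
      · simp; norm_num
      · have hy0 : 0 < y := zero_lt_one.trans hy.1
        simp only [hf]
        rw [indicator_of_mem hy, Real.rpow_neg_one, mul_inv_cancel₀ hy0.ne']
    rw [mem_ofPred_eq, H0, hI]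
    norm_num
  have key := hC f ⟨hfm.aemeasurable, hN.trans_lt one_lt_top⟩ (1 / 2) (by norm_num)
  have htop : powMeasure (-1) {y | 1 / 2 < |H0 (-1) f y|} = ⊤ :=
    top_le_iff.1 (powMeasure_neg_one_Ioi_two ▸ measure_mono hsub)
  rw [htop, ENNReal.mul_top (by norm_num), top_le_iff] at key
  exact ENNReal.mul_ne_top coe_ne_top (hN.trans_lt one_lt_top).ne key

theorem stmt1 (ξ δ p : ℝ) (hp : 1 ≤ p) :
    IsWeakType (H0 ξ) p δ ↔
      ((p = 1 ∧ ξ ≠ -1) → δ ≤ (ξ + 1) * p - 1) ∧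
      (¬ (p = 1 ∧ ξ ≠ -1) → δ < (ξ + 1) * p - 1) := by
  constructor
  · intro h
    refine ⟨fun ⟨h1, _⟩ => ?_, fun hn => ?_⟩
    · subst h1
      linarith [le_of_isWeakType_H0_one h]
    · rcases hp.eq_or_lt with rfl | hp'
      · obtain rfl : ξ = -1 := by
          by_contra hξ
          exact hn ⟨rfl, hξ⟩
        refine lt_of_le_of_ne (by linarith [le_of_isWeakType_H0_one h]) fun hδ => ?_
        norm_num at hδ
        subst hδ
        exact not_isWeakType_H0_neg_one h
      · exact lt_of_isWeakType_H0 hp' h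
  · rintro ⟨h1, h2⟩
    by_cases hc : p = 1 ∧ ξ ≠ -1
    · obtain ⟨rfl, hξ⟩ := hc
      rcases (h1 ⟨rfl, hξ⟩).eq_or_lt with h | h
      · obtain rfl : δ = ξ := by linarith
        exact isWeakType_H0_one_self hξ
      · exact isWeakType_H0_of_lt le_rfl h
    · exact isWeakType_H0_of_lt hp (h2 hc)

end
end

section
/- Let ξ, δ ∈ ℝ and 1 ≤ p < ∞. The dual Hardy-type operator H_∞^ξ is of restricted weak type (p,p) with respect to (ℝ₊, x^δ dx) if and only if −ξp − 1 ≤ δ, with the inequality strictened to −ξp − 1 < δ in case ξ = 0. -/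
open MeasureTheory Set ENNReal
open scoped NNReal

noncomputable section

/-- The dual Hardy-type operator `H_∞^ξ`. -/
def Hinf (ξ : ℝ) (f : ℝ → ℝ) (x : ℝ) : ℝ :=
  x ^ ξ * ∫ y in Ioi x, f y * y ^ (-ξ - 1)

lemma powMeasure_apply (δ : ℝ) (s : Set ℝ) :
    powMeasure δ s = ∫⁻ x in s ∩ Ioi 0, ENNReal.ofReal (x ^ δ) := by
  rw [powMeasure, withDensity_apply', Measure.restrict_restrict' measurableSet_Ioi]

lemma powMeasure_mono_of_pos {δ : ℝ} {s t : Set ℝ} (h : ∀ x ∈ s, 0 < x → x ∈ t) :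
    powMeasure δ s ≤ powMeasure δ t := by
  rw [powMeasure_apply, powMeasure_apply]
  exact lintegral_mono_set fun x hx => ⟨h x hx.1 hx.2, hx.2⟩

lemma lintegral_rpow_sub_one_le {s u : ℝ} (hs : s ≠ 0) (hu : 0 < u) :
    ∫⁻ y in {y : ℝ | 0 < y ∧ y ^ s ≤ u}, ENNReal.ofReal (y ^ (s - 1)) ≤
      ENNReal.ofReal (u / |s|) := by
  obtain ⟨r, hr, rfl⟩ : ∃ r : ℝ, 0 < r ∧ r ^ s = u :=
    ⟨u ^ s⁻¹, Real.rpow_pos_of_pos hu _, Real.rpow_inv_rpow hu.le hs⟩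
  rcases lt_or_gt_of_ne hs with hs | hs
  · calc _ ≤ ∫⁻ y in Ici r, ENNReal.ofReal (y ^ (s - 1)) :=
          lintegral_mono_set fun y hy => (Real.rpow_le_rpow_iff_of_neg hy.1 hr hs).1 hy.2
      _ = ∫⁻ y in Ioi r, ENNReal.ofReal (y ^ (s - 1)) := by
          rw [restrict_Ioi_eq_restrict_Ici]
      _ = ENNReal.ofReal (∫ y in Ioi r, y ^ (s - 1)) := by
          refine (ofReal_integral_eq_lintegral_ofReal
            (integrableOn_Ioi_rpow_of_lt (by linarith) hr) ?_).symm
          filter_upwards [ae_restrict_mem measurableSet_Ioi] with y hy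
          exact Real.rpow_nonneg (hr.trans hy).le _
      _ ≤ _ := by
          rw [integral_Ioi_rpow_of_lt (by linarith) hr, sub_add_cancel, abs_of_neg hs, neg_div,
            div_neg]
  · calc _ ≤ ∫⁻ y in Ioc 0 r, ENNReal.ofReal (y ^ (s - 1)) :=
          lintegral_mono_set fun y hy => ⟨hy.1, (Real.rpow_le_rpow_iff hy.1.le hr.le hs).1 hy.2⟩
      _ = ENNReal.ofReal (∫ y in Ioc 0 r, y ^ (s - 1)) := by
          refine (ofReal_integral_eq_lintegral_ofReal ?_ ?_).symm
          · exact (intervalIntegrable_iff_integrableOn_Ioc_of_le hr.le).1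
              (intervalIntegral.intervalIntegrable_rpow' (by linarith))
          · filter_upwards [ae_restrict_mem measurableSet_Ioc] with y hy
            exact Real.rpow_nonneg hy.1.le _
      _ ≤ _ := by
          rw [← intervalIntegral.integral_of_le hr.le, integral_rpow (Or.inl (by linarith)),
            sub_add_cancel, Real.zero_rpow hs.ne', sub_zero, abs_of_pos hs]

/-- The `ℝ≥0∞`-valued form of `H_∞^ξ` applied to the indicator function of `E`. -/
def hinfLIntegral (ξ : ℝ) (E : Set ℝ) (x : ℝ) : ℝ≥0∞ :=
  ∫⁻ y in E ∩ Ioi x, ENNReal.ofReal (x ^ ξ * y ^ (-ξ - 1))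

lemma ofReal_abs_Hinf_indicator_le (ξ : ℝ) {E : Set ℝ} (hE : MeasurableSet E) {x : ℝ}
    (hx : 0 < x) :
    ENNReal.ofReal |Hinf ξ (E.indicator 1) x| ≤ hinfLIntegral ξ E x := by
  rw [Hinf, ← integral_const_mul, ← Real.enorm_eq_ofReal_abs]
  refine (enorm_integral_le_lintegral_enorm _).trans ?_
  rw [hinfLIntegral, ← Measure.restrict_restrict hE, ← lintegral_indicator hE]
  refine setLIntegral_mono' measurableSet_Ioi fun y hy => ?_
  by_cases h : y ∈ E
  · simp only [h, indicator_of_mem, Pi.one_apply, one_mul]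
    rw [Real.enorm_of_nonneg]
    exact mul_nonneg (Real.rpow_nonneg hx.le _) (Real.rpow_nonneg (hx.trans hy).le _)
  · simp [h]

lemma hinfLIntegral_anti {ξ η : ℝ} (h : η ≤ ξ) {E : Set ℝ} (hE : MeasurableSet E) {x : ℝ}
    (hx : 0 < x) : hinfLIntegral ξ E x ≤ hinfLIntegral η E x := by
  refine setLIntegral_mono' (hE.inter measurableSet_Ioi) fun y hy => ENNReal.ofReal_le_ofReal ?_
  have hxy : x < y := hy.2
  have hy0 : 0 < y := hx.trans hxy
  have key (ζ : ℝ) : x ^ ζ * y ^ (-ζ - 1) = (x / y) ^ ζ * y⁻¹ := by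
    rw [Real.div_rpow hx.le hy0.le, Real.rpow_sub hy0, Real.rpow_neg hy0.le, Real.rpow_one]
    field_simp
  rw [key, key]
  exact mul_le_mul_of_nonneg_right (Real.rpow_le_rpow_of_exponent_ge (by positivity)
    ((div_le_one hy0).2 hxy.le) h) (by positivity)

lemma hinfLIntegral_le_of_critical {η p v : ℝ} (hη : η ≠ 0) (hp : 1 ≤ p) (hv : 0 < v)
    {E : Set ℝ} (hEv : powMeasure (-η * p - 1) E ≤ ENNReal.ofReal (v ^ p))
    {x : ℝ} (hx : 0 < x) :
    hinfLIntegral η E x ≤ ENNReal.ofReal (x ^ η * (v * (1 / |η| + 1))) := by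
  have hxη : 0 ≤ x ^ η := Real.rpow_nonneg hx.le _
  have hmeas : Measurable fun y : ℝ => y ^ (-η) := by fun_prop
  set A : Set ℝ := {y : ℝ | 0 < y ∧ y ^ (-η) ≤ v}
  set B : Set ℝ := {y : ℝ | v < y ^ (-η)}
  have hB : MeasurableSet B := measurableSet_lt measurable_const hmeas
  have hA : ∫⁻ y in A, ENNReal.ofReal (y ^ (-η - 1)) ≤ ENNReal.ofReal (v / |η|) := by
    simpa using lintegral_rpow_sub_one_le (neg_ne_zero.2 hη) hv
  have hfar : ∫⁻ y in B ∩ (E ∩ Ioi 0), ENNReal.ofReal (y ^ (-η - 1)) ≤ ENNReal.ofReal v := by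
    calc _ ≤ ∫⁻ y in B ∩ (E ∩ Ioi 0),
            ENNReal.ofReal (v ^ (1 - p)) * ENNReal.ofReal (y ^ (-η * p - 1)) := by
          refine setLIntegral_mono (by fun_prop) fun y hy => ?_
          have hy0 : (0 : ℝ) < y := hy.2.2
          rw [← ENNReal.ofReal_mul (by positivity)]
          refine ENNReal.ofReal_le_ofReal ?_
          have h1 : y ^ (-η - 1) = (y ^ (-η)) ^ (1 - p) * y ^ (-η * p - 1) := by
            rw [← Real.rpow_mul hy0.le, ← Real.rpow_add hy0]
            ring_nf
          rw [h1]
          exact mul_le_mul_of_nonneg_right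
            (Real.rpow_le_rpow_of_nonpos hv (le_of_lt hy.1) (by linarith)) (by positivity)
      _ = ENNReal.ofReal (v ^ (1 - p)) *
            ∫⁻ y in B ∩ (E ∩ Ioi 0), ENNReal.ofReal (y ^ (-η * p - 1)) :=
          lintegral_const_mul _ (by fun_prop)
      _ ≤ ENNReal.ofReal (v ^ (1 - p)) * ENNReal.ofReal (v ^ p) := by
          gcongr
          refine le_trans ?_ hEv
          rw [powMeasure_apply]
          exact lintegral_mono_set inter_subset_right
      _ = ENNReal.ofReal v := by
          rw [← ENNReal.ofReal_mul (by positivity), ← Real.rpow_add hv]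
          simp
  calc hinfLIntegral η E x
      = ENNReal.ofReal (x ^ η) * ∫⁻ y in E ∩ Ioi x, ENNReal.ofReal (y ^ (-η - 1)) := by
        rw [hinfLIntegral, ← lintegral_const_mul _ (by fun_prop)]
        simp_rw [ENNReal.ofReal_mul hxη]
    _ ≤ ENNReal.ofReal (x ^ η) *
          ∫⁻ y in A ∪ B ∩ (E ∩ Ioi 0), ENNReal.ofReal (y ^ (-η - 1)) := by
        gcongr
        intro y hy
        have hy0 : 0 < y := hx.trans hy.2
        rcases le_or_gt (y ^ (-η)) v with h | h
        · exact Or.inl ⟨hy0, h⟩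
        · exact Or.inr ⟨h, hy.1, hy0⟩
    _ ≤ ENNReal.ofReal (x ^ η) * (ENNReal.ofReal (v / |η|) + ENNReal.ofReal v) := by
        gcongr
        exact (lintegral_union_le _ _ _).trans (add_le_add hA hfar)
    _ = ENNReal.ofReal (x ^ η * (v * (1 / |η| + 1))) := by
        rw [← ENNReal.ofReal_add (by positivity) hv.le, ← ENNReal.ofReal_mul hxη]
        congr 1
        ring

lemma le_ofReal_mul_of_forall_pos {X M : ℝ≥0∞} {C : ℝ} (hC : 0 < C) (hM : M < ⊤)
    (h : ∀ m : ℝ, 0 < m → M ≤ ENNReal.ofReal m → X ≤ ENNReal.ofReal (C * m)) :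
    X ≤ ENNReal.ofReal C * M := by
  rcases eq_or_ne M 0 with rfl | h0
  · refine ENNReal.le_of_forall_pos_le_add fun ε hε _ => ?_
    have hε' : (0 : ℝ) < ε := hε
    have := h (ε / C) (by positivity) zero_le
    rw [mul_div_cancel₀ _ hC.ne', ENNReal.ofReal_coe_nnreal] at this
    simpa using this
  · have := h M.toReal (ENNReal.toReal_pos h0 hM.ne) (ENNReal.ofReal_toReal hM.ne).ge
    rwa [ENNReal.ofReal_mul hC.le, ENNReal.ofReal_toReal hM.ne] at this

lemma isRestrictedWeakType_Hinf_of_critical {ξ η p : ℝ} (hη : η ≠ 0) (hηξ : η ≤ ξ)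
    (hp : 1 ≤ p) : IsRestrictedWeakType (Hinf ξ) p (-η * p - 1) := by
  have hp0 : 0 < p := by linarith
  set c : ℝ := 1 / |η| + 1
  have hc : 0 < c := by positivity
  have hηp : 0 < |-η * p| := abs_pos.2 (mul_ne_zero (neg_ne_zero.2 hη) hp0.ne')
  refine ⟨(c ^ p / |-η * p|).toNNReal, fun E hE hfin l hl => ?_⟩
  refine le_ofReal_mul_of_forall_pos (by positivity) hfin fun m hm hEm => ?_
  obtain ⟨v, hv, rfl⟩ : ∃ v : ℝ, 0 < v ∧ v ^ p = m :=
    ⟨m ^ p⁻¹, Real.rpow_pos_of_pos hm _, Real.rpow_inv_rpow hm.le hp0.ne'⟩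
  have hsub : ∀ x ∈ {y | l < |Hinf ξ (E.indicator 1) y|}, 0 < x →
      x ∈ {y : ℝ | 0 < y ∧ y ^ (-η * p) ≤ (v * c / l) ^ p} := by
    intro x hx hx0
    refine ⟨hx0, ?_⟩
    have h1 : ENNReal.ofReal l < ENNReal.ofReal (x ^ η * (v * c)) :=
      ((ENNReal.ofReal_lt_ofReal_iff (hl.trans hx)).2 hx).trans_le <|
        (ofReal_abs_Hinf_indicator_le ξ hE hx0).trans <|
          (hinfLIntegral_anti hηξ hE hx0).trans (hinfLIntegral_le_of_critical hη hp hv hEm hx0)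
    have h2 : l < x ^ η * (v * c) := (ENNReal.ofReal_lt_ofReal_iff (by positivity)).1 h1
    rw [Real.rpow_mul hx0.le]
    refine Real.rpow_le_rpow (by positivity) ?_ hp0.le
    rw [Real.rpow_neg hx0.le, le_div_iff₀ hl, inv_mul_le_iff₀ (by positivity)]
    exact h2.le
  have hlevel : powMeasure (-η * p - 1) {y | l < |Hinf ξ (E.indicator 1) y|} ≤
      ENNReal.ofReal ((v * c / l) ^ p / |-η * p|) := by
    refine (powMeasure_mono_of_pos hsub).trans ?_
    rw [powMeasure_apply]
    exact (lintegral_mono_set inter_subset_left).trans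
      (lintegral_rpow_sub_one_le (abs_pos.1 hηp) (by positivity))
  refine (mul_le_mul_right hlevel _).trans_eq ?_
  rw [← ENNReal.ofReal_mul (by positivity), Real.div_rpow (by positivity) hl.le,
    Real.mul_rpow hv.le hc.le]
  congr 1
  field_simp

lemma hinfLIntegral_le_inv {ξ : ℝ} (hξ : 0 < ξ) (E : Set ℝ) {x : ℝ} (hx : 0 < x) :
    hinfLIntegral ξ E x ≤ ENNReal.ofReal ξ⁻¹ := by
  have hxξ : 0 ≤ x ^ ξ := Real.rpow_nonneg hx.le _
  calc hinfLIntegral ξ E x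
      = ENNReal.ofReal (x ^ ξ) * ∫⁻ y in E ∩ Ioi x, ENNReal.ofReal (y ^ (-ξ - 1)) := by
        rw [hinfLIntegral, ← lintegral_const_mul _ (by fun_prop)]
        simp_rw [ENNReal.ofReal_mul hxξ]
    _ ≤ ENNReal.ofReal (x ^ ξ) * ENNReal.ofReal (x ^ (-ξ) / |-ξ|) := by
        gcongr
        refine le_trans (lintegral_mono_set fun y hy => ?_)
          (lintegral_rpow_sub_one_le (neg_ne_zero.2 hξ.ne') (Real.rpow_pos_of_pos hx _))
        exact ⟨hx.trans hy.2,
          Real.rpow_le_rpow_of_nonpos hx (le_of_lt hy.2) (by linarith)⟩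
    _ = ENNReal.ofReal ξ⁻¹ := by
        rw [← ENNReal.ofReal_mul hxξ, abs_neg, abs_of_pos hξ, Real.rpow_neg hx.le]
        congr 1
        field_simp

lemma hinfLIntegral_eq_lintegral_indicator (ξ : ℝ) {E : Set ℝ} (hE : MeasurableSet E) (x : ℝ) :
    hinfLIntegral ξ E x = ∫⁻ y, {q : ℝ × ℝ | q.2 ∈ E ∧ q.1 < q.2}.indicator
      (fun q => ENNReal.ofReal (q.1 ^ ξ * q.2 ^ (-ξ - 1))) (x, y) := by
  rw [hinfLIntegral, ← lintegral_indicator (hE.inter measurableSet_Ioi)]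
  rfl

lemma measurable_indicator_hinf_kernel (ξ : ℝ) {E : Set ℝ} (hE : MeasurableSet E) :
    Measurable ({q : ℝ × ℝ | q.2 ∈ E ∧ q.1 < q.2}.indicator
      (fun q : ℝ × ℝ => ENNReal.ofReal (q.1 ^ ξ * q.2 ^ (-ξ - 1)))) :=
  Measurable.indicator (by fun_prop)
    ((measurable_snd hE).inter (measurableSet_lt measurable_fst measurable_snd))

lemma measurable_hinfLIntegral (ξ : ℝ) {E : Set ℝ} (hE : MeasurableSet E) :
    Measurable (hinfLIntegral ξ E) := by
  rw [funext (hinfLIntegral_eq_lintegral_indicator ξ hE)]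
  exact (measurable_indicator_hinf_kernel ξ hE).lintegral_prod_right'

lemma lintegral_hinfLIntegral_le {ξ : ℝ} (hξ : 0 < ξ) {E : Set ℝ} (hE : MeasurableSet E) :
    ∫⁻ x, hinfLIntegral ξ E x ∂(powMeasure (-1)) ≤
      ENNReal.ofReal ξ⁻¹ * powMeasure (-1) E := by
  have hk := measurable_indicator_hinf_kernel ξ hE
  set k := ({q : ℝ × ℝ | q.2 ∈ E ∧ q.1 < q.2}.indicator
      (fun q : ℝ × ℝ => ENNReal.ofReal (q.1 ^ ξ * q.2 ^ (-ξ - 1)))) with hkdef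
  calc ∫⁻ x, hinfLIntegral ξ E x ∂(powMeasure (-1))
      = ∫⁻ x in Ioi 0, ∫⁻ y, ENNReal.ofReal (x ^ (-1 : ℝ)) * k (x, y) := by
        rw [powMeasure, lintegral_withDensity_eq_lintegral_mul₀ (by fun_prop)
          (measurable_hinfLIntegral ξ hE).aemeasurable]
        refine lintegral_congr fun x => ?_
        rw [lintegral_const_mul _ (by fun_prop), Pi.mul_apply,
          hinfLIntegral_eq_lintegral_indicator ξ hE]
    _ = ∫⁻ y, ∫⁻ x in Ioi 0, ENNReal.ofReal (x ^ (-1 : ℝ)) * k (x, y) :=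
        lintegral_lintegral_swap (by unfold Function.uncurry; fun_prop)
    _ ≤ ∫⁻ y, (E ∩ Ioi 0).indicator
          (fun y => ENNReal.ofReal ξ⁻¹ * ENNReal.ofReal (y ^ (-1 : ℝ))) y := by
        refine lintegral_mono fun y => ?_
        by_cases hy : y ∈ E ∩ Ioi 0
        · have hy0 : (0 : ℝ) < y := hy.2
          rw [indicator_of_mem hy]
          calc _ ≤ ∫⁻ x in Ioi 0, {x : ℝ | 0 < x ∧ x ^ ξ ≤ y ^ ξ}.indicator
                (fun x => ENNReal.ofReal (y ^ (-ξ - 1)) * ENNReal.ofReal (x ^ (ξ - 1))) x := by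
                refine setLIntegral_mono' measurableSet_Ioi fun x hx => ?_
                have hx0 : (0 : ℝ) < x := hx
                by_cases hxy : x < y
                · rw [hkdef, indicator_of_mem (by exact ⟨hy.1, hxy⟩), indicator_of_mem
                    (by exact ⟨hx0, Real.rpow_le_rpow hx0.le hxy.le hξ.le⟩),
                    ← ENNReal.ofReal_mul (by positivity), ← ENNReal.ofReal_mul (by positivity),
                    Real.rpow_sub hx0, Real.rpow_neg hx0.le, Real.rpow_one]
                  exact (congrArg ENNReal.ofReal (by ring)).le
                · rw [hkdef, indicator_of_notMem (fun h => hxy h.2), mul_zero]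
                  exact zero_le
            _ ≤ ∫⁻ x, {x : ℝ | 0 < x ∧ x ^ ξ ≤ y ^ ξ}.indicator
                (fun x => ENNReal.ofReal (y ^ (-ξ - 1)) * ENNReal.ofReal (x ^ (ξ - 1))) x :=
                setLIntegral_le_lintegral _ _
            _ ≤ ENNReal.ofReal (y ^ (-ξ - 1)) * ENNReal.ofReal (y ^ ξ / |ξ|) := by
                refine (lintegral_indicator_le _ _).trans ?_
                rw [lintegral_const_mul _ (by fun_prop)]
                gcongr
                exact lintegral_rpow_sub_one_le hξ.ne' (by positivity)
            _ = _ := by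
                rw [← ENNReal.ofReal_mul (by positivity), ← ENNReal.ofReal_mul (by positivity),
                  abs_of_pos hξ, Real.rpow_sub hy0, Real.rpow_neg hy0.le, Real.rpow_neg hy0.le,
                  Real.rpow_one]
                congr 1
                field_simp
        · rw [indicator_of_notMem hy]
          refine (setLIntegral_eq_zero measurableSet_Ioi fun x hx => ?_).le
          rw [hkdef, indicator_of_notMem (fun h => hy ⟨h.1, lt_trans hx h.2⟩), mul_zero]
          rfl
    _ = ENNReal.ofReal ξ⁻¹ * powMeasure (-1) E := by
        rw [lintegral_indicator (hE.inter measurableSet_Ioi),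
          lintegral_const_mul _ (by fun_prop), powMeasure_apply]

lemma isRestrictedWeakType_Hinf_neg_one {ξ p : ℝ} (hξ : 0 < ξ) (hp : 1 ≤ p) :
    IsRestrictedWeakType (Hinf ξ) p (-1) := by
  refine ⟨(ξ⁻¹ ^ (p - 1) * ξ⁻¹).toNNReal, fun E hE _ l hl => ?_⟩
  change _ ≤ ENNReal.ofReal (ξ⁻¹ ^ (p - 1) * ξ⁻¹) * _
  rcases le_or_gt l ξ⁻¹ with hle | hlt
  · have hlevel : powMeasure (-1) {y | l < |Hinf ξ (E.indicator 1) y|} ≤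
        powMeasure (-1) {y | ENNReal.ofReal l ≤ hinfLIntegral ξ E y} :=
      powMeasure_mono_of_pos fun x hx hx0 =>
        (ENNReal.ofReal_le_ofReal (le_of_lt hx)).trans (ofReal_abs_Hinf_indicator_le ξ hE hx0)
    have hl' : l ^ p = l ^ (p - 1) * l := by
      rw [Real.rpow_sub_one hl.ne', div_mul_cancel₀ _ hl.ne']
    rw [hl', ENNReal.ofReal_mul (by positivity), ENNReal.ofReal_mul (by positivity),
      mul_assoc, mul_assoc]
    refine mul_le_mul' (ENNReal.ofReal_le_ofReal
      (Real.rpow_le_rpow hl.le hle (by linarith))) ?_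
    exact (mul_le_mul_right hlevel _).trans <|
      (mul_meas_ge_le_lintegral₀ (measurable_hinfLIntegral ξ hE).aemeasurable _).trans
        (lintegral_hinfLIntegral_le hξ hE)
  · have hzero : powMeasure (-1) {y | l < |Hinf ξ (E.indicator 1) y|} ≤ powMeasure (-1) ∅ := by
      refine powMeasure_mono_of_pos fun x hx hx0 => ?_
      have h := (ofReal_abs_Hinf_indicator_le ξ hE hx0).trans (hinfLIntegral_le_inv hξ E hx0)
      rw [ENNReal.ofReal_le_ofReal_iff (by positivity)] at h
      exact absurd (hlt.trans hx) (not_lt.2 h)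
    rw [measure_empty, nonpos_iff_eq_zero] at hzero
    rw [hzero, mul_zero]
    exact zero_le

lemma Hinf_indicator_Ioc_one_two (ξ : ℝ) {x : ℝ} (hx : x ≤ 1) :
    Hinf ξ ((Ioc 1 2).indicator 1) x = x ^ ξ * ∫ y in (1 : ℝ)..2, y ^ (-ξ - 1) := by
  have h (y : ℝ) : (Ioc (1 : ℝ) 2).indicator (1 : ℝ → ℝ) y * y ^ (-ξ - 1) =
      (Ioc (1 : ℝ) 2).indicator (fun y => y ^ (-ξ - 1)) y := by
    by_cases hy : y ∈ Ioc (1 : ℝ) 2 <;> simp [hy]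
  rw [Hinf, intervalIntegral.integral_of_le one_le_two]
  simp_rw [h]
  rw [setIntegral_indicator measurableSet_Ioc,
    inter_eq_self_of_subset_right (s := Ioi x) fun y hy => lt_of_le_of_lt hx hy.1]

lemma integral_one_two_rpow_pos (s : ℝ) : 0 < ∫ y in (1 : ℝ)..2, y ^ s := by
  refine intervalIntegral.intervalIntegral_pos_of_pos_on
    (intervalIntegral.intervalIntegrable_rpow (Or.inr ?_))
    (fun x hx => Real.rpow_pos_of_pos (one_pos.trans hx.1) _) one_lt_two
  rw [uIcc_of_le one_le_two]
  exact fun h => absurd h.1 (by norm_num)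

lemma powMeasure_Ioc_one_two_lt_top (δ : ℝ) : powMeasure δ (Ioc 1 2) < ⊤ := by
  rw [powMeasure_apply]
  refine (lintegral_mono_set inter_subset_left).trans_lt ?_
  have h : IntegrableOn (fun x : ℝ => x ^ δ) (Ioc 1 2) := by
    refine (intervalIntegrable_iff_integrableOn_Ioc_of_le one_le_two).1
      (intervalIntegral.intervalIntegrable_rpow (Or.inr ?_))
    rw [uIcc_of_le one_le_two]
    exact fun h => absurd h.1 (by norm_num)
  exact h.lintegral_lt_top

lemma min_one_two_rpow_mul_le {r x : ℝ} (s : ℝ) (hr : 0 < r) (hx : x ∈ Ioo r (2 * r)) :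
    min 1 (2 ^ s) * r ^ s ≤ x ^ s := by
  have hx0 : 0 < x := hr.trans hx.1
  rcases le_or_gt 0 s with hs | hs
  · calc _ ≤ 1 * r ^ s := by gcongr; exact min_le_left _ _
      _ ≤ x ^ s := by rw [one_mul]; exact Real.rpow_le_rpow hr.le hx.1.le hs
  · calc _ ≤ 2 ^ s * r ^ s := by gcongr; exact min_le_right _ _
      _ = (2 * r) ^ s := (Real.mul_rpow two_pos.le hr.le).symm
      _ ≤ x ^ s := Real.rpow_le_rpow_of_nonpos hx0 hx.2.le hs.le

lemma nonneg_of_rpow_bounded {e A D : ℝ} (hA : 0 < A)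
    (h : ∀ r : ℝ, 0 < r → r ≤ 1 / 2 → A * r ^ e ≤ D) : 0 ≤ e := by
  by_contra! he
  set B : ℝ := max ((1 / 2) ^ e) (D / A + 1)
  have hB : 0 < B := lt_max_of_lt_left (by positivity)
  have hr : (B ^ e⁻¹) ^ e = B := Real.rpow_inv_rpow hB.le he.ne
  have h1 := h (B ^ e⁻¹) (by positivity) <| by
    rw [← Real.rpow_le_rpow_iff_of_neg (by norm_num) (by positivity) he, hr]
    exact le_max_left _ _
  rw [hr] at h1
  have h2 : A * (D / A + 1) ≤ A * B := by gcongr; exact le_max_right _ _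
  have h3 : A * (D / A + 1) = D + A := by field_simp
  linarith

lemma IsRestrictedWeakType.exponent_nonneg {ξ δ p : ℝ}
    (h : IsRestrictedWeakType (Hinf ξ) p δ) : 0 ≤ ξ * p + δ + 1 := by
  obtain ⟨C, hC⟩ := h
  set c := ∫ y in (1 : ℝ)..2, y ^ (-ξ - 1) with hc
  have hc0 : 0 < c := integral_one_two_rpow_pos _
  have hD : C * powMeasure δ (Ioc 1 2) < ⊤ :=
    ENNReal.mul_lt_top ENNReal.coe_lt_top (powMeasure_Ioc_one_two_lt_top δ)
  set k : ℝ := min 1 (2 ^ ξ)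
  set k' : ℝ := min 1 (2 ^ δ)
  have hk : 0 < k := lt_min one_pos (by positivity)
  have hk' : 0 < k' := lt_min one_pos (by positivity)
  refine nonneg_of_rpow_bounded (A := (c * k / 2) ^ p * k')
    (D := (C * powMeasure δ (Ioc 1 2)).toReal) (by positivity) fun r hr hr2 => ?_
  set l : ℝ := c * k / 2 * r ^ ξ
  have hl : 0 < l := by positivity
  have hlevel : ENNReal.ofReal (k' * r ^ δ * r) ≤
      powMeasure δ {y | l < |Hinf ξ ((Ioc 1 2).indicator 1) y|} := by
    calc ENNReal.ofReal (k' * r ^ δ * r)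
        = ∫⁻ x in Ioo r (2 * r), ENNReal.ofReal (k' * r ^ δ) := by
          rw [setLIntegral_const, Real.volume_Ioo, ← ENNReal.ofReal_mul (by positivity)]
          ring_nf
      _ ≤ ∫⁻ x in Ioo r (2 * r), ENNReal.ofReal (x ^ δ) :=
          setLIntegral_mono' measurableSet_Ioo fun x hx =>
            ENNReal.ofReal_le_ofReal (min_one_two_rpow_mul_le δ hr hx)
      _ ≤ _ := by
          rw [powMeasure_apply]
          refine lintegral_mono_set fun x hx => ⟨?_, hr.trans hx.1⟩
          have hx0 : 0 < x := hr.trans hx.1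
          change l < |_|
          rw [Hinf_indicator_Ioc_one_two ξ (by linarith [hx.2]), ← hc, abs_of_pos (by positivity)]
          have h1 : k * r ^ ξ * c ≤ x ^ ξ * c := by
            gcongr; exact min_one_two_rpow_mul_le ξ hr hx
          have h2 : l = k * r ^ ξ * c / 2 := by ring
          have h3 : 0 < k * r ^ ξ * c := by positivity
          linarith
  have hmain := (mul_le_mul_right hlevel _).trans
    (hC (Ioc 1 2) measurableSet_Ioc (powMeasure_Ioc_one_two_lt_top δ) l hl)
  rw [← ENNReal.ofReal_mul (by positivity), ENNReal.ofReal_le_iff_le_toReal hD.ne] at hmain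
  refine le_of_eq_of_le ?_ hmain
  rw [Real.mul_rpow (by positivity) (by positivity), ← Real.rpow_mul hr.le,
    Real.rpow_add hr, Real.rpow_add hr, Real.rpow_one]
  ring

lemma powMeasure_neg_one_Ioo_zero_one : powMeasure (-1) (Ioo 0 1) = ⊤ := by
  rw [powMeasure_apply, inter_eq_self_of_subset_left fun x hx => hx.1]
  by_contra h
  have hint : IntegrableOn (fun x : ℝ => x ^ (-1 : ℝ)) (Ioo 0 1) := by
    refine ⟨by fun_prop, (hasFiniteIntegral_iff_ofReal ?_).2 (lt_top_iff_ne_top.2 h)⟩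
    filter_upwards [ae_restrict_mem measurableSet_Ioo] with x hx
    exact Real.rpow_nonneg hx.1.le _
  exact absurd ((intervalIntegral.integrableOn_Ioo_rpow_iff one_pos).1 hint) (lt_irrefl _)

lemma not_isRestrictedWeakType_Hinf_zero_neg_one (p : ℝ) :
    ¬ IsRestrictedWeakType (Hinf 0) p (-1) := by
  rintro ⟨C, hC⟩
  set c := ∫ y in (1 : ℝ)..2, y ^ (-(0 : ℝ) - 1) with hc
  have hc0 : 0 < c := integral_one_two_rpow_pos _
  have hlevel : powMeasure (-1) (Ioo 0 1) ≤
      powMeasure (-1) {y | c / 2 < |Hinf 0 ((Ioc 1 2).indicator 1) y|} := by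
    refine measure_mono fun x hx => ?_
    change c / 2 < |_|
    rw [Hinf_indicator_Ioc_one_two 0 hx.2.le, ← hc, Real.rpow_zero, one_mul, abs_of_pos hc0]
    linarith
  rw [powMeasure_neg_one_Ioo_zero_one, top_le_iff] at hlevel
  have h := hC (Ioc 1 2) measurableSet_Ioc (powMeasure_Ioc_one_two_lt_top _) (c / 2)
    (by positivity)
  rw [hlevel, ENNReal.mul_top (by simp only [ne_eq, ENNReal.ofReal_eq_zero, not_le]; positivity),
    top_le_iff] at h
  exact (ENNReal.mul_lt_top ENNReal.coe_lt_top (powMeasure_Ioc_one_two_lt_top _)).ne h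

theorem stmt5 (ξ δ p : ℝ) (hp : 1 ≤ p) :
    IsRestrictedWeakType (Hinf ξ) p δ ↔
      ((ξ = 0 → -ξ * p - 1 < δ) ∧ (ξ ≠ 0 → -ξ * p - 1 ≤ δ)) := by
  have hp0 : 0 < p := by linarith
  constructor
  · intro h
    have he := h.exponent_nonneg
    refine ⟨?_, fun _ => by linarith⟩
    rintro rfl
    refine lt_of_le_of_ne (by linarith) fun hδ => ?_
    obtain rfl : δ = -1 := by linarith
    exact not_isRestrictedWeakType_Hinf_zero_neg_one p h
  · rintro ⟨h0, h1⟩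
    have hδ : -(-(δ + 1) / p) * p - 1 = δ := by field_simp; ring
    have hle : -(δ + 1) / p ≤ ξ := by
      rw [div_le_iff₀ hp0]
      by_cases hξ : ξ = 0
      · linarith [h0 hξ]
      · linarith [h1 hξ]
    by_cases hη : -(δ + 1) / p = 0
    · obtain rfl : δ = -1 := by rw [hη] at hδ; linarith
      refine isRestrictedWeakType_Hinf_neg_one (lt_of_le_of_ne (hη ▸ hle) fun hξ => ?_) hp
      have := h0 hξ.symm
      rw [← hξ] at this
      linarith
    · rw [← hδ]
      exact isRestrictedWeakType_Hinf_of_critical hη hle hp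

end
end
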